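/- Let K, L be finite simplicial complexes with K ∩ L = 2^σ, the full simplex on σ, where dim σ = n, and suppose K (or L) has an n-dimensional completely connected component containing σ. Then 𝓗^{n,n}(K ∪ L) ≅ (𝓗^{n,n}(K) ⊕ 𝓗^{n,n}(L))/ℤ and 𝓗^{p,q}(K ∪ L) ≅ 𝓗^{p,q}(K) ⊕ 𝓗^{p,q}(L) for all other (p,q). -/

import Mathlib

open Finset

/-- A finite abstract simplicial complex with vertices in `ℕ`. -/
structure SC where
  faces : Finset (Finset ℕ)
  down_closed : ∀ ⦃s t : Finset ℕ⦄, s ∈ faces → t ⊆ s → t ∈ faces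

namespace SC

/-- The vertex set of a simplicial complex. -/
def verts (K : SC) : Finset ℕ := K.faces.sup id

/-- The dimension of a simplicial complex (dimension of `{∅}` is `-1`). -/
def dim (K : SC) : ℤ := ((K.faces.sup Finset.card : ℕ) : ℤ) - 1

/-- The link of a simplex. -/
def link (K : SC) (σ : Finset ℕ) : SC where
  faces := K.faces.filter fun t => σ ∪ t ∈ K.faces ∧ Disjoint σ t
  down_closed := by
    intro s t hs hts
    simp only [mem_filter] at hs ⊢
    refine ⟨K.down_closed hs.1 hts, K.down_closed hs.2.1 (union_subset_union_right hts),
      hs.2.2.mono_right ?_⟩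
    exact_mod_cast hts

/-- `K₁` is a subcomplex of `K`. -/
def IsSub (K₁ K : SC) : Prop := K₁.faces ⊆ K.faces

/-- Union of two simplicial complexes. -/
def union (K L : SC) : SC where
  faces := K.faces ∪ L.faces
  down_closed := by
    intro s t hs hts
    rcases mem_union.mp hs with h | h
    · exact mem_union_left _ (K.down_closed h hts)
    · exact mem_union_right _ (L.down_closed h hts)

/-- Intersection of two simplicial complexes. -/
def inter (K L : SC) : SC where
  faces := K.faces ∩ L.faces
  down_closed := by
    intro s t hs hts
    rw [mem_inter] at hs ⊢
    exact ⟨K.down_closed hs.1 hts, L.down_closed hs.2 hts⟩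

/-- The join of two simplicial complexes. -/
def join (K L : SC) : SC where
  faces := (K.faces ×ˢ L.faces).image fun x => x.1 ∪ x.2
  down_closed := by
    intro s t hs hts
    simp only [mem_image, mem_product] at hs ⊢
    obtain ⟨⟨a, b⟩, ⟨ha, hb⟩, rfl⟩ := hs
    refine ⟨⟨t ∩ a, t \ a⟩, ⟨K.down_closed ha inter_subset_right,
      L.down_closed hb fun x hx => ?_⟩, ?_⟩
    · rcases mem_union.mp (hts (mem_sdiff.mp hx).1) with h | h
      · exact absurd h (mem_sdiff.mp hx).2
      · exact h
    · ext x
      simp only [mem_union, mem_inter, mem_sdiff]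
      constructor
      · rintro (⟨h, _⟩ | ⟨h, _⟩) <;> exact h
      · intro hx
        by_cases hxa : x ∈ a
        · exact Or.inl ⟨hx, hxa⟩
        · exact Or.inr ⟨hx, hxa⟩

end SC
namespace SC
open Finset

/-- The sign of a vertex `v` in a simplex, given by its position in the canonical ordering. -/
def psgn (v : ℕ) (s : Finset ℕ) : ℤ := (-1) ^ (s.filter fun u => u < v).card

variable (G : Type) [AddCommGroup G]

/-- The submodule of functions supported on a given set of indices. -/
def suppM {α : Type} (P : α → Prop) : Submodule ℤ (α → G) where
  carrier := {c | ∀ x, c x ≠ 0 → P x}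
  add_mem' := by
    intro a b ha hb x hx
    by_cases h : a x = 0
    · exact hb x (by simpa [h] using hx)
    · exact ha x h
  zero_mem' := fun x hx => absurd rfl hx
  smul_mem' := by
    intro z a ha x hx
    exact ha x fun h => hx (by simp [h])

end SC
namespace SC
open Finset

/-- Pairs of simplices, indexing the double complex `N^{*,*}`. -/
abbrev Pr := Finset ℕ × Finset ℕ

variable (G : Type) [AddCommGroup G]

/-- The `(p,q)`-graded piece of the double complex `N^{*,*}(K)` spanned by `σ ⊗ τ`, `σ ⊆ τ`. -/
def Ngr (K : SC) (p q : ℤ) : Submodule ℤ (Pr → G) :=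
  suppM G fun x => x.1 ⊆ x.2 ∧ x.2 ∈ K.faces ∧ x.1 ≠ ∅ ∧
    (x.1.card : ℤ) = p + 1 ∧ (x.2.card : ℤ) = q + 1

/-- The `(p,q)`-graded piece of the reduced double complex `Ñ^{*,*}(K)`. -/
def NgrR (K : SC) (p q : ℤ) : Submodule ℤ (Pr → G) :=
  suppM G fun x => x.1 ⊆ x.2 ∧ x.2 ∈ K.faces ∧
    (x.1.card : ℤ) = p + 1 ∧ (x.2.card : ℤ) = q + 1

/-- The vertical differential `σ ⊗ τ ↦ (-1)^{|σ|} σ ⊗ δτ` (unreduced). -/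
def dvF (K : SC) (c : Pr → G) : Pr → G := fun x =>
  if x.2 ∈ K.faces ∧ x.1 ⊆ x.2 ∧ x.1 ≠ ∅ then
    ((-1 : ℤ) ^ x.1.card) •
      ∑ w ∈ x.2, if x.1 ⊆ x.2.erase w then psgn w x.2 • c (x.1, x.2.erase w) else 0
  else 0

/-- The horizontal differential `σ ⊗ τ ↦ dσ ⊗ τ` (unreduced). -/
def dhF (K : SC) (c : Pr → G) : Pr → G := fun x =>
  if x.2 ∈ K.faces ∧ x.1 ⊆ x.2 ∧ x.1 ≠ ∅ then
    ∑ v ∈ x.2 \ x.1, psgn v (insert v x.1) • c (insert v x.1, x.2)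
  else 0

/-- The vertical differential (reduced). -/
def dvRF (K : SC) (c : Pr → G) : Pr → G := fun x =>
  if x.2 ∈ K.faces ∧ x.1 ⊆ x.2 then
    ((-1 : ℤ) ^ x.1.card) •
      ∑ w ∈ x.2, if x.1 ⊆ x.2.erase w then psgn w x.2 • c (x.1, x.2.erase w) else 0
  else 0

/-- The horizontal differential (reduced). -/
def dhRF (K : SC) (c : Pr → G) : Pr → G := fun x =>
  if x.2 ∈ K.faces ∧ x.1 ⊆ x.2 then
    ∑ v ∈ x.2 \ x.1, psgn v (insert v x.1) • c (insert v x.1, x.2)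
  else 0

/-- The vertical differential as a linear map (unreduced). -/
def dvL (K : SC) : (Pr → G) →ₗ[ℤ] (Pr → G) where
  toFun := dvF G K
  map_add' := by
    intro a b
    funext x
    simp only [dvF, Pi.add_apply]
    split_ifs with h
    · rw [← smul_add, ← Finset.sum_add_distrib]
      congr 1
      refine Finset.sum_congr rfl fun w _ => ?_
      split_ifs with h2
      · simp [smul_add]
      · simp
    · simp
  map_smul' := by
    intro z a
    funext x
    simp only [dvF, Pi.smul_apply, RingHom.id_apply]
    split_ifs with h
    · rw [smul_comm z]
      congr 1
      rw [Finset.smul_sum]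
      refine Finset.sum_congr rfl fun w _ => ?_
      split_ifs with h2
      · rw [smul_smul, smul_smul, mul_comm]
      · simp
    · simp

/-- The horizontal differential as a linear map (unreduced). -/
def dhL (K : SC) : (Pr → G) →ₗ[ℤ] (Pr → G) where
  toFun := dhF G K
  map_add' := by
    intro a b
    funext x
    simp only [dhF, Pi.add_apply]
    split_ifs with h
    · rw [← Finset.sum_add_distrib]
      exact Finset.sum_congr rfl fun v _ => smul_add _ _ _
    · simp
  map_smul' := by
    intro z a
    funext x
    simp only [dhF, Pi.smul_apply, RingHom.id_apply]
    split_ifs with h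
    · rw [Finset.smul_sum]
      refine Finset.sum_congr rfl fun v _ => ?_
      rw [smul_smul, smul_smul, mul_comm]
    · simp

/-- The vertical differential as a linear map (reduced). -/
def dvRL (K : SC) : (Pr → G) →ₗ[ℤ] (Pr → G) where
  toFun := dvRF G K
  map_add' := by
    intro a b
    funext x
    simp only [dvRF, Pi.add_apply]
    split_ifs with h
    · rw [← smul_add, ← Finset.sum_add_distrib]
      congr 1
      refine Finset.sum_congr rfl fun w _ => ?_
      split_ifs with h2
      · simp [smul_add]
      · simp
    · simp
  map_smul' := by
    intro z a
    funext x
    simp only [dvRF, Pi.smul_apply, RingHom.id_apply]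
    split_ifs with h
    · rw [smul_comm z]
      congr 1
      rw [Finset.smul_sum]
      refine Finset.sum_congr rfl fun w _ => ?_
      split_ifs with h2
      · rw [smul_smul, smul_smul, mul_comm]
      · simp
    · simp

/-- The horizontal differential as a linear map (reduced). -/
def dhRL (K : SC) : (Pr → G) →ₗ[ℤ] (Pr → G) where
  toFun := dhRF G K
  map_add' := by
    intro a b
    funext x
    simp only [dhRF, Pi.add_apply]
    split_ifs with h
    · rw [← Finset.sum_add_distrib]
      exact Finset.sum_congr rfl fun v _ => smul_add _ _ _
    · simp
  map_smul' := by
    intro z a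
    funext x
    simp only [dhRF, Pi.smul_apply, RingHom.id_apply]
    split_ifs with h
    · rw [Finset.smul_sum]
      refine Finset.sum_congr rfl fun v _ => ?_
      rw [smul_smul, smul_smul, mul_comm]
    · simp

/-- The total differential `Δ(σ⊗τ) = dσ⊗τ + (-1)^{|σ|}σ⊗δτ` (unreduced). -/
def dL (K : SC) : (Pr → G) →ₗ[ℤ] (Pr → G) := dhL G K + dvL G K

/-- The total differential (reduced). -/
def dRL (K : SC) : (Pr → G) →ₗ[ℤ] (Pr → G) := dhRL G K + dvRL G K

/-- Cocycles for the `E₁`-page: `ker Δ_v` in bidegree `(p,q)`. -/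
def Z1 (K : SC) (p q : ℤ) : Submodule ℤ (Pr → G) :=
  Ngr G K p q ⊓ LinearMap.ker (dvL G K)

/-- Coboundaries for the `E₁`-page. -/
def B1 (K : SC) (p q : ℤ) : Submodule ℤ (Pr → G) :=
  Submodule.map (dvL G K) (Ngr G K p (q - 1)) ⊓ Ngr G K p q

/-- The `E₁`-page of the cohomeology spectral sequence in bidegree `(p,q)`. -/
abbrev E1 (K : SC) (p q : ℤ) :=
  ↥(Z1 G K p q) ⧸ Submodule.comap (Z1 G K p q).subtype (B1 G K p q)

/-- Reduced `E₁`-cocycles. -/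
def Z1R (K : SC) (p q : ℤ) : Submodule ℤ (Pr → G) :=
  NgrR G K p q ⊓ LinearMap.ker (dvRL G K)

/-- Reduced `E₁`-coboundaries. -/
def B1R (K : SC) (p q : ℤ) : Submodule ℤ (Pr → G) :=
  Submodule.map (dvRL G K) (NgrR G K p (q - 1)) ⊓ NgrR G K p q

/-- The `E₁`-page of the reduced cohomeology spectral sequence. -/
abbrev E1R (K : SC) (p q : ℤ) :=
  ↥(Z1R G K p q) ⧸ Submodule.comap (Z1R G K p q).subtype (B1R G K p q)

/-- `E₂`-cocycles: vertical cocycles whose horizontal differential is a vertical coboundary. -/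
def Z2 (K : SC) (p q : ℤ) : Submodule ℤ (Pr → G) :=
  Ngr G K p q ⊓ LinearMap.ker (dvL G K) ⊓
    Submodule.comap (dhL G K) (Submodule.map (dvL G K) (Ngr G K (p - 1) (q - 1)))

/-- `E₂`-coboundaries. -/
def B2 (K : SC) (p q : ℤ) : Submodule ℤ (Pr → G) :=
  (Submodule.map (dvL G K) (Ngr G K p (q - 1)) ⊔
    Submodule.map (dhL G K) (Ngr G K (p + 1) q ⊓ LinearMap.ker (dvL G K))) ⊓ Ngr G K p q

/-- The cohomeology group `𝓗^{p,q}(K; G)`: the `E₂`-page of the cohomeology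
spectral sequence in bidegree `(p,q)`. -/
abbrev HH (K : SC) (p q : ℤ) :=
  ↥(Z2 G K p q) ⧸ Submodule.comap (Z2 G K p q).subtype (B2 G K p q)

/-- Reduced `E₂`-cocycles. -/
def Z2R (K : SC) (p q : ℤ) : Submodule ℤ (Pr → G) :=
  NgrR G K p q ⊓ LinearMap.ker (dvRL G K) ⊓
    Submodule.comap (dhRL G K) (Submodule.map (dvRL G K) (NgrR G K (p - 1) (q - 1)))

/-- Reduced `E₂`-coboundaries. -/
def B2R (K : SC) (p q : ℤ) : Submodule ℤ (Pr → G) :=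
  (Submodule.map (dvRL G K) (NgrR G K p (q - 1)) ⊔
    Submodule.map (dhRL G K) (NgrR G K (p + 1) q ⊓ LinearMap.ker (dvRL G K))) ⊓ NgrR G K p q

/-- The reduced cohomeology group `𝓗̃^{p,q}(K; G)`. -/
abbrev HHR (K : SC) (p q : ℤ) :=
  ↥(Z2R G K p q) ⧸ Submodule.comap (Z2R G K p q).subtype (B2R G K p q)

/-- Total-degree-`n` part of the total complex of `N^{*,*}(K)`. -/
def Tgr (K : SC) (n : ℤ) : Submodule ℤ (Pr → G) :=
  suppM G fun x => x.1 ⊆ x.2 ∧ x.2 ∈ K.faces ∧ x.1 ≠ ∅ ∧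
    (x.2.card : ℤ) - (x.1.card : ℤ) = n

/-- Total-degree-`n` part of the total complex of `Ñ^{*,*}(K)`. -/
def TgrR (K : SC) (n : ℤ) : Submodule ℤ (Pr → G) :=
  suppM G fun x => x.1 ⊆ x.2 ∧ x.2 ∈ K.faces ∧
    (x.2.card : ℤ) - (x.1.card : ℤ) = n

/-- The degree-`n` cohomology of the total complex of `N^{*,*}(K)`. -/
abbrev TotH (K : SC) (n : ℤ) :=
  ↥(Tgr G K n ⊓ LinearMap.ker (dL G K)) ⧸
    Submodule.comap (Tgr G K n ⊓ LinearMap.ker (dL G K)).subtype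
      (Submodule.map (dL G K) (Tgr G K (n - 1)) ⊓ Tgr G K n)

/-- The degree-`n` cohomology of the total complex of `Ñ^{*,*}(K)`. -/
abbrev TotHR (K : SC) (n : ℤ) :=
  ↥(TgrR G K n ⊓ LinearMap.ker (dRL G K)) ⧸
    Submodule.comap (TgrR G K n ⊓ LinearMap.ker (dRL G K)).subtype
      (Submodule.map (dRL G K) (TgrR G K (n - 1)) ⊓ TgrR G K n)

/-- The filtration `F^p` of the total complex by first degree. -/
def Fil (p : ℤ) : Submodule ℤ (Pr → G) :=
  suppM G fun x => (x.1.card : ℤ) ≤ p + 1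

/-- The `E_∞`-term of the cohomeology spectral sequence in bidegree `(p,p)`:
the `p`-th graded piece of the filtration induced on `H^0` of the total complex. -/
abbrev Einf0 (K : SC) (p : ℤ) :=
  ↥(Tgr ℤ K 0 ⊓ LinearMap.ker (dL ℤ K) ⊓ Fil ℤ p) ⧸
    Submodule.comap (Tgr ℤ K 0 ⊓ LinearMap.ker (dL ℤ K) ⊓ Fil ℤ p).subtype
      ((Tgr ℤ K 0 ⊓ LinearMap.ker (dL ℤ K) ⊓ Fil ℤ (p - 1)) ⊔
        (Submodule.map (dL ℤ K) (Tgr ℤ K (-1)) ⊓ Tgr ℤ K 0 ⊓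
          LinearMap.ker (dL ℤ K) ⊓ Fil ℤ p))

end SC
namespace SC
open Finset

/-- Two equal-dimensional simplices of `K₁` are adjacent if they share a common
codimension-one face (a common facet). -/
def cAdj (K₁ : SC) (s t : Finset ℕ) : Prop :=
  s ∈ K₁.faces ∧ t ∈ K₁.faces ∧ s.card = t.card ∧ (s ∩ t).card + 1 = s.card

/-- `K₁` is completely connected: any two simplices of the same dimension are
joined by a chain of simplices of that dimension, consecutive ones sharing a
common facet. -/
def CompConn (K₁ : SC) : Prop :=
  ∀ s ∈ K₁.faces, ∀ t ∈ K₁.faces, s.card = t.card → Relation.ReflTransGen (cAdj K₁) s t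

/-- `K₁` is a completely connected component of `K`: a maximal completely
connected subcomplex. -/
def IsCCComp (K K₁ : SC) : Prop :=
  K₁.IsSub K ∧ CompConn K₁ ∧ ∀ K₂ : SC, K₂.IsSub K → CompConn K₂ → K₁.IsSub K₂ → K₂ = K₁

end SC
namespace SC
open Finset

lemma psgn_mul_self (v : ℕ) (s : Finset ℕ) : psgn v s * psgn v s = 1 := by
  rw [psgn, ← mul_pow]
  simp

lemma psgn_mul_psgn_erase {T : Finset ℕ} {u w : ℕ} (hu : u ∈ T) (hw : w ∈ T) (h : u ≠ w) :
    psgn u T * psgn w (T.erase u) = -(psgn w T * psgn u (T.erase w)) := by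
  wlog huw : u < w generalizing u w
  · rw [this hw hu h.symm (by omega), neg_neg]
  have h1 : (T.erase w).filter (fun x => x < u) = T.filter fun x => x < u := by
    ext x
    simp only [mem_filter, mem_erase]
    constructor
    · exact fun hx => ⟨hx.1.2, hx.2⟩
    · exact fun hx => ⟨⟨by omega, hx.1⟩, hx.2⟩
  have h2 : (T.erase u).filter (fun x => x < w) = (T.filter fun x => x < w).erase u := by
    ext x
    simp only [mem_filter, mem_erase]
    tauto
  have h3 : u ∈ T.filter fun x => x < w := mem_filter.mpr ⟨hu, huw⟩
  simp only [psgn, h1, h2]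
  rw [← card_erase_add_one h3, pow_succ]
  ring

lemma sum_sum_erase_eq_zero {D : Finset ℕ} {f : ℕ → ℕ → ℤ}
    (hf : ∀ u ∈ D, ∀ w ∈ D, u ≠ w → f u w = -f w u) :
    ∑ u ∈ D, ∑ w ∈ D.erase u, f u w = 0 := by
  have h1 : ∑ u ∈ D, ∑ w ∈ D.erase u, f u w = ∑ w ∈ D, ∑ u ∈ D.erase w, f u w := by
    refine Finset.sum_comm' fun x y => ?_
    simp only [mem_erase]
    tauto
  have h2 : ∑ w ∈ D, ∑ u ∈ D.erase w, f u w = -∑ w ∈ D, ∑ u ∈ D.erase w, f w u := by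
    rw [← Finset.sum_neg_distrib]
    refine Finset.sum_congr rfl fun w hw => ?_
    rw [← Finset.sum_neg_distrib]
    refine Finset.sum_congr rfl fun u hu => ?_
    rw [mem_erase] at hu
    exact hf u hu.2 w hw hu.1
  omega

/-- The pairs of simplices spanning `N^{*,*}(K)`. -/
def IsPair (K : SC) (ρ τ : Finset ℕ) : Prop := τ ∈ K.faces ∧ ρ ⊆ τ ∧ ρ ≠ ∅

lemma IsPair.erase {K : SC} {ρ τ : Finset ℕ} (h : K.IsPair ρ τ) {w : ℕ} (hw : w ∈ τ \ ρ) :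
    K.IsPair ρ (τ.erase w) :=
  ⟨K.down_closed h.1 (erase_subset _ _),
    subset_erase.mpr ⟨h.2.1, (mem_sdiff.mp hw).2⟩, h.2.2⟩

lemma IsPair.insert {K : SC} {ρ τ : Finset ℕ} (h : K.IsPair ρ τ) {w : ℕ} (hw : w ∈ τ \ ρ) :
    K.IsPair (insert w ρ) τ :=
  ⟨h.1, insert_subset (mem_sdiff.mp hw).1 h.2.1, insert_ne_empty _ _⟩

lemma dvL_apply {K : SC} {ρ τ : Finset ℕ} (h : K.IsPair ρ τ) (c : Pr → ℤ) :
    dvL ℤ K c (ρ, τ) = (-1) ^ ρ.card * ∑ w ∈ τ \ ρ, psgn w τ * c (ρ, τ.erase w) := by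
  have h' : (ρ, τ).2 ∈ K.faces ∧ (ρ, τ).1 ⊆ (ρ, τ).2 ∧ (ρ, τ).1 ≠ ∅ := h
  simp only [dvL, LinearMap.coe_mk, AddHom.coe_mk, dvF]
  rw [if_pos h', smul_eq_mul, ← Finset.sum_filter]
  congr 1
  refine Finset.sum_congr ?_ fun w _ => smul_eq_mul _ _
  ext w
  simp only [mem_filter, mem_sdiff, subset_erase]
  have := h.2.1
  tauto

lemma dvL_apply_of_not {K : SC} {ρ τ : Finset ℕ} (h : ¬K.IsPair ρ τ) (c : Pr → ℤ) :
    dvL ℤ K c (ρ, τ) = 0 :=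
  if_neg h

lemma dhL_apply {K : SC} {ρ τ : Finset ℕ} (h : K.IsPair ρ τ) (c : Pr → ℤ) :
    dhL ℤ K c (ρ, τ) = ∑ v ∈ τ \ ρ, psgn v (insert v ρ) * c (insert v ρ, τ) :=
  if_pos h

lemma dhL_apply_of_not {K : SC} {ρ τ : Finset ℕ} (h : ¬K.IsPair ρ τ) (c : Pr → ℤ) :
    dhL ℤ K c (ρ, τ) = 0 :=
  if_neg h

lemma dvL_dvL (K : SC) (c : Pr → ℤ) : dvL ℤ K (dvL ℤ K c) = 0 := by
  ext ⟨ρ, τ⟩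
  by_cases h : K.IsPair ρ τ
  swap
  · exact dvL_apply_of_not h _
  rw [dvL_apply h]
  have : ∀ w ∈ τ \ ρ, psgn w τ * dvL ℤ K c (ρ, τ.erase w) = ∑ u ∈ (τ \ ρ).erase w,
      (-1) ^ ρ.card * (psgn w τ * psgn u (τ.erase w) * c (ρ, (τ.erase w).erase u)) := by
    intro w hw
    rw [dvL_apply (h.erase hw), erase_sdiff_comm, Finset.mul_sum, Finset.mul_sum]
    exact Finset.sum_congr rfl fun u _ => by ring
  rw [Finset.sum_congr rfl this, sum_sum_erase_eq_zero, mul_zero, Pi.zero_apply]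
  intro u hu w hw huw
  rw [psgn_mul_psgn_erase (mem_sdiff.mp hu).1 (mem_sdiff.mp hw).1 huw, erase_right_comm]
  ring

lemma dhL_dvL (K : SC) (c : Pr → ℤ) : dhL ℤ K (dvL ℤ K c) = -dvL ℤ K (dhL ℤ K c) := by
  ext ⟨ρ, τ⟩
  rw [Pi.neg_apply]
  by_cases h : K.IsPair ρ τ
  swap
  · rw [dhL_apply_of_not h, dvL_apply_of_not h, neg_zero]
  rw [dhL_apply h, dvL_apply h]
  have h1 : ∀ v ∈ τ \ ρ, psgn v (insert v ρ) * dvL ℤ K c (insert v ρ, τ) =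
      ∑ w ∈ (τ \ ρ).erase v, -((-1) ^ ρ.card *
        (psgn w τ * (psgn v (insert v ρ) * c (insert v ρ, τ.erase w)))) := by
    intro v hv
    rw [dvL_apply (h.insert hv), sdiff_insert, card_insert_of_notMem (mem_sdiff.mp hv).2,
      Finset.mul_sum, Finset.mul_sum]
    exact Finset.sum_congr rfl fun u _ => by ring
  have h2 : ∀ w ∈ τ \ ρ, psgn w τ * dhL ℤ K c (ρ, τ.erase w) =
      ∑ v ∈ (τ \ ρ).erase w,
        psgn w τ * (psgn v (insert v ρ) * c (insert v ρ, τ.erase w)) := by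
    intro w hw
    rw [dhL_apply (h.erase hw), erase_sdiff_comm, Finset.mul_sum]
  rw [Finset.sum_congr rfl h1, Finset.sum_congr rfl h2, Finset.mul_sum, ← Finset.sum_neg_distrib]
  simp only [Finset.mul_sum, ← Finset.sum_neg_distrib]
  refine Finset.sum_comm' fun x y => ?_
  simp only [mem_erase]
  tauto

lemma apply_eq_zero_of_mem_Ngr {K : SC} {p q : ℤ} {c : Pr → ℤ} (hc : c ∈ Ngr ℤ K p q)
    {ρ τ : Finset ℕ}
    (h : ¬(K.IsPair ρ τ ∧ (ρ.card : ℤ) = p + 1 ∧ (τ.card : ℤ) = q + 1)) : c (ρ, τ) = 0 := by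
  by_contra h0
  obtain ⟨h1, h2, h3, h4⟩ := hc (ρ, τ) h0
  exact h ⟨⟨h2, h1, h3⟩, h4⟩

lemma mem_Ngr_of {K : SC} {p q : ℤ} {c : Pr → ℤ}
    (h : ∀ ρ τ, c (ρ, τ) ≠ 0 →
      K.IsPair ρ τ ∧ (ρ.card : ℤ) = p + 1 ∧ (τ.card : ℤ) = q + 1) : c ∈ Ngr ℤ K p q := by
  rintro ⟨ρ, τ⟩ h0
  obtain ⟨⟨h1, h2, h3⟩, h4⟩ := h ρ τ h0
  exact ⟨h2, h1, h3, h4⟩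

lemma dvL_mem_Ngr {K : SC} {p q : ℤ} {c : Pr → ℤ} (hc : c ∈ Ngr ℤ K p (q - 1)) :
    dvL ℤ K c ∈ Ngr ℤ K p q := by
  refine mem_Ngr_of fun ρ τ h0 => ?_
  by_cases h : K.IsPair ρ τ
  swap
  · exact absurd (dvL_apply_of_not h c) h0
  rw [dvL_apply h] at h0
  obtain ⟨w, hw, hne⟩ := Finset.exists_ne_zero_of_sum_ne_zero (right_ne_zero_of_mul h0)
  obtain ⟨-, -, -, h4, h5⟩ := hc _ (right_ne_zero_of_mul hne)
  have := card_erase_add_one (mem_sdiff.mp hw).1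
  exact ⟨h, h4, by simp only at h5; omega⟩

lemma dhL_mem_Ngr {K : SC} {p q : ℤ} {c : Pr → ℤ} (hc : c ∈ Ngr ℤ K p q) :
    dhL ℤ K c ∈ Ngr ℤ K (p - 1) q := by
  refine mem_Ngr_of fun ρ τ h0 => ?_
  by_cases h : K.IsPair ρ τ
  swap
  · exact absurd (dhL_apply_of_not h c) h0
  rw [dhL_apply h] at h0
  obtain ⟨w, hw, hne⟩ := Finset.exists_ne_zero_of_sum_ne_zero h0
  obtain ⟨-, -, -, h4, h5⟩ := hc _ (right_ne_zero_of_mul hne)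
  have := card_insert_of_notMem (mem_sdiff.mp hw).2
  exact ⟨h, by simp only at h4; omega, h5⟩

/-- Restriction of cochains to the pairs whose second simplex lies in `K`. -/
def res (K : SC) : (Pr → ℤ) →ₗ[ℤ] (Pr → ℤ) where
  toFun c x := if x.2 ∈ K.faces then c x else 0
  map_add' a b := by
    ext x
    by_cases h : x.2 ∈ K.faces <;> simp [h]
  map_smul' z a := by
    ext x
    by_cases h : x.2 ∈ K.faces <;> simp [h]

lemma res_apply_of_mem {K : SC} {ρ τ : Finset ℕ} (h : τ ∈ K.faces) (c : Pr → ℤ) :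
    res K c (ρ, τ) = c (ρ, τ) :=
  if_pos h

lemma res_apply_of_notMem {K : SC} {ρ τ : Finset ℕ} (h : τ ∉ K.faces) (c : Pr → ℤ) :
    res K c (ρ, τ) = 0 :=
  if_neg h

lemma res_dvL {M K : SC} (hM : M.IsSub K) (c : Pr → ℤ) :
    res M (dvL ℤ K c) = dvL ℤ M (res M c) := by
  ext ⟨ρ, τ⟩
  by_cases h : M.IsPair ρ τ
  · rw [res_apply_of_mem h.1, dvL_apply h, dvL_apply ⟨hM h.1, h.2⟩]
    congr 1
    exact Finset.sum_congr rfl fun w hw => by rw [res_apply_of_mem (h.erase hw).1]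
  · rw [dvL_apply_of_not h]
    by_cases hτ : τ ∈ M.faces
    · rw [res_apply_of_mem hτ, dvL_apply_of_not fun h' => h ⟨hτ, h'.2⟩]
    · exact res_apply_of_notMem hτ _

lemma res_dhL {M K : SC} (hM : M.IsSub K) (c : Pr → ℤ) :
    res M (dhL ℤ K c) = dhL ℤ M (res M c) := by
  ext ⟨ρ, τ⟩
  by_cases h : M.IsPair ρ τ
  · rw [res_apply_of_mem h.1, dhL_apply h, dhL_apply ⟨hM h.1, h.2⟩]
    exact Finset.sum_congr rfl fun w _ => by rw [res_apply_of_mem h.1]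
  · rw [dhL_apply_of_not h]
    by_cases hτ : τ ∈ M.faces
    · rw [res_apply_of_mem hτ, dhL_apply_of_not fun h' => h ⟨hτ, h'.2⟩]
    · exact res_apply_of_notMem hτ _

lemma res_mem_Ngr {M K : SC} {p q : ℤ} {c : Pr → ℤ} (hc : c ∈ Ngr ℤ K p q) :
    res M c ∈ Ngr ℤ M p q := by
  refine mem_Ngr_of fun ρ τ h0 => ?_
  by_cases hτ : τ ∈ M.faces
  · rw [res_apply_of_mem hτ] at h0
    obtain ⟨h1, -, h3, h4⟩ := hc _ h0
    exact ⟨⟨hτ, h1, h3⟩, h4⟩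
  · exact absurd (res_apply_of_notMem hτ c) h0

lemma Ngr_mono {M K : SC} (hM : M.IsSub K) (p q : ℤ) : Ngr ℤ M p q ≤ Ngr ℤ K p q :=
  fun _ hc x hx => (hc x hx).imp_right fun h => h.imp_left fun h' => hM h'

lemma res_eq_self {K : SC} {p q : ℤ} {c : Pr → ℤ} (hc : c ∈ Ngr ℤ K p q) : res K c = c := by
  ext ⟨ρ, τ⟩
  by_cases hτ : τ ∈ K.faces
  · exact res_apply_of_mem hτ c
  · rw [res_apply_of_notMem hτ, apply_eq_zero_of_mem_Ngr hc fun h => hτ h.1.1]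

lemma res_map_dvL {M K : SC} (hM : M.IsSub K) {p q : ℤ} {c : Pr → ℤ}
    (hc : c ∈ Submodule.map (dvL ℤ K) (Ngr ℤ K p q)) :
    res M c ∈ Submodule.map (dvL ℤ M) (Ngr ℤ M p q) := by
  obtain ⟨a, ha, rfl⟩ := hc
  exact ⟨res M a, res_mem_Ngr ha, (res_dvL hM a).symm⟩

lemma res_mem_Z2 {M K : SC} (hM : M.IsSub K) {p q : ℤ} {c : Pr → ℤ} (hc : c ∈ Z2 ℤ K p q) :
    res M c ∈ Z2 ℤ M p q := by
  obtain ⟨⟨h1, h2⟩, h3⟩ := hc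
  refine ⟨⟨res_mem_Ngr h1, ?_⟩, ?_⟩
  · change dvL ℤ M (res M c) = 0
    rw [← res_dvL hM, LinearMap.mem_ker.mp h2, map_zero]
  · change dhL ℤ M (res M c) ∈ Submodule.map (dvL ℤ M) (Ngr ℤ M (p - 1) (q - 1))
    rw [← res_dhL hM]
    exact res_map_dvL hM h3

lemma res_mem_B2 {M K : SC} (hM : M.IsSub K) {p q : ℤ} {c : Pr → ℤ} (hc : c ∈ B2 ℤ K p q) :
    res M c ∈ B2 ℤ M p q := by
  obtain ⟨h1, h2⟩ := hc
  refine ⟨?_, res_mem_Ngr h2⟩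
  obtain ⟨a, ha, b, ⟨g, ⟨hg, hg0⟩, rfl⟩, rfl⟩ := Submodule.mem_sup.mp h1
  rw [map_add]
  refine Submodule.add_mem_sup (res_map_dvL hM ha) ⟨res M g, ⟨res_mem_Ngr hg, ?_⟩, ?_⟩
  · change dvL ℤ M (res M g) = 0
    rw [← res_dvL hM, LinearMap.mem_ker.mp hg0, map_zero]
  · exact (res_dhL hM g).symm

/-- Restriction of cohomeology classes to a subcomplex. -/
def resHH {M K : SC} (hM : M.IsSub K) (p q : ℤ) : HH ℤ K p q →ₗ[ℤ] HH ℤ M p q :=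
  Submodule.mapQ _ _ ((res M).restrict fun _ hc => res_mem_Z2 hM hc)
    fun _ hc => res_mem_B2 hM hc

lemma IsSub_union_left (K L : SC) : K.IsSub (K.union L) := Finset.subset_union_left

lemma IsSub_union_right (K L : SC) : L.IsSub (K.union L) := Finset.subset_union_right

lemma eq_zero_of_res {K L : SC} {c : Pr → ℤ}
    (hc : ∀ ρ τ, ¬(K.union L).IsPair ρ τ → c (ρ, τ) = 0)
    (hK : res K c = 0) (hL : res L c = 0) : c = 0 := by
  ext ⟨ρ, τ⟩
  by_cases h : (K.union L).IsPair ρ τ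
  swap
  · exact hc ρ τ h
  rcases mem_union.mp h.1 with h | h
  · rw [← res_apply_of_mem h c, hK]
  · rw [← res_apply_of_mem h c, hL]

lemma exists_glue {K L S : SC} (hS : K.faces ∩ L.faces = S.faces) {p q : ℤ} {a b : Pr → ℤ}
    (ha : a ∈ Ngr ℤ K p q) (hb : b ∈ Ngr ℤ L p q) (hab : res S a = res S b) :
    ∃ c ∈ Ngr ℤ (K.union L) p q, res K c = a ∧ res L c = b := by
  refine ⟨fun x => if x.2 ∈ K.faces then a x else b x, fun x hx => ?_, ?_, ?_⟩
  · by_cases h : x.2 ∈ K.faces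
    · simp only [h, if_true] at hx
      exact Ngr_mono (IsSub_union_left K L) p q ha x hx
    · simp only [h, if_false] at hx
      exact Ngr_mono (IsSub_union_right K L) p q hb x hx
  · ext ⟨ρ, τ⟩
    by_cases h : τ ∈ K.faces
    · simp [res_apply_of_mem h, h]
    · rw [res_apply_of_notMem h, apply_eq_zero_of_mem_Ngr ha fun h' => h h'.1.1]
  · ext ⟨ρ, τ⟩
    by_cases h : τ ∈ L.faces
    · rw [res_apply_of_mem h]
      by_cases h' : τ ∈ K.faces
      · have hτ : τ ∈ S.faces := hS ▸ mem_inter.mpr ⟨h', h⟩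
        simpa [h', res_apply_of_mem hτ] using congrFun hab (ρ, τ)
      · simp [h']
    · rw [res_apply_of_notMem h, apply_eq_zero_of_mem_Ngr hb fun h' => h h'.1.1]

/-- The full simplex `2^σ`. -/
def simplex (σ : Finset ℕ) : SC where
  faces := σ.powerset
  down_closed _ _ hs hts := mem_powerset.mpr (hts.trans (mem_powerset.mp hs))

lemma IsPair.subset {σ ρ τ : Finset ℕ} (h : (simplex σ).IsPair ρ τ) : τ ⊆ σ :=
  mem_powerset.mp h.1

open Classical in
lemma exists_dvL_eq_of_simplex {σ : Finset ℕ} {p q : ℤ} {e : Pr → ℤ}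
    (he : e ∈ Ngr ℤ (simplex σ) p q) (hv : dvL ℤ (simplex σ) e = 0) (hσ : e (σ, σ) = 0) :
    ∃ g ∈ Ngr ℤ (simplex σ) p (q - 1), dvL ℤ (simplex σ) g = e := by
  have hu : ∀ ρ : Finset ℕ, ∃ u, ρ ⊆ σ → ρ ≠ σ → u ∈ σ \ ρ := by
    intro ρ
    by_cases h : ρ ⊆ σ ∧ ρ ≠ σ
    · obtain ⟨u, hu⟩ := sdiff_nonempty.mpr fun h' => h.2 (h.1.antisymm h')
      exact ⟨u, fun _ _ => hu⟩
    · exact ⟨0, fun h1 h2 => absurd ⟨h1, h2⟩ h⟩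
  choose u hu using hu
  set g : Pr → ℤ := fun x =>
    if (simplex σ).IsPair x.1 x.2 ∧ x.1 ≠ σ ∧ u x.1 ∉ x.2 then
      (-1) ^ x.1.card * (psgn (u x.1) (insert (u x.1) x.2) * e (x.1, insert (u x.1) x.2))
    else 0 with hg
  refine ⟨g, mem_Ngr_of fun ρ τ h0 => ?_, ?_⟩
  · by_cases h : (simplex σ).IsPair ρ τ ∧ ρ ≠ σ ∧ u ρ ∉ τ
    · simp only [hg] at h0
      rw [if_pos h] at h0
      obtain ⟨-, -, -, h4, h5⟩ := he _ (right_ne_zero_of_mul (right_ne_zero_of_mul h0))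
      have := card_insert_of_notMem h.2.2
      exact ⟨h.1, h4, by simp only at h5; omega⟩
    · exact absurd (if_neg h) h0
  · ext ⟨ρ, τ⟩
    by_cases h : (simplex σ).IsPair ρ τ
    swap
    · rw [dvL_apply_of_not h, apply_eq_zero_of_mem_Ngr he fun h' => h h'.1]
    rw [dvL_apply h]
    by_cases hρ : ρ = σ
    · subst hρ
      obtain rfl : τ = ρ := h.subset.antisymm h.2.1
      simp [hσ]
    have huρ := mem_sdiff.mp (hu ρ (h.2.1.trans h.subset) hρ)
    have hg_apply : ∀ w ∈ τ \ ρ, u ρ ∉ τ.erase w → g (ρ, τ.erase w) = (-1) ^ ρ.card *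
        (psgn (u ρ) (insert (u ρ) (τ.erase w)) * e (ρ, insert (u ρ) (τ.erase w))) :=
      fun w hw h' => if_pos ⟨h.erase hw, hρ, h'⟩
    have hsq : ((-1 : ℤ) ^ ρ.card) * (-1) ^ ρ.card = 1 := by
      rw [← mul_pow]
      simp
    by_cases huτ : u ρ ∈ τ
    · rw [Finset.sum_eq_single (u ρ)]
      · rw [hg_apply _ (mem_sdiff.mpr ⟨huτ, huρ.2⟩) (notMem_erase _ _), insert_erase huτ]
        linear_combination (e (ρ, τ) * (-1) ^ ρ.card * (-1) ^ ρ.card) *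
          psgn_mul_self (u ρ) τ + e (ρ, τ) * hsq
      · intro w _ hwu
        have : g (ρ, τ.erase w) = 0 :=
          if_neg fun h' => h'.2.2 (mem_erase.mpr ⟨hwu.symm, huτ⟩)
        rw [this, mul_zero]
      · exact fun h' => absurd (mem_sdiff.mpr ⟨huτ, huρ.2⟩) h'
    · set T := insert (u ρ) τ
      have huT : u ρ ∈ T := mem_insert_self _ _
      have hpair : (simplex σ).IsPair ρ T :=
        ⟨mem_powerset.mpr (insert_subset huρ.1 h.subset),
          h.2.1.trans (subset_insert _ _), h.2.2⟩
      have h0 := congrFun hv (ρ, T)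
      rw [dvL_apply hpair, insert_sdiff_of_notMem _ huρ.2,
        Finset.sum_insert fun h' => huτ (mem_sdiff.mp h').1, Pi.zero_apply,
        erase_insert huτ] at h0
      have h1 := (mul_eq_zero.mp h0).resolve_left (pow_ne_zero _ (by norm_num))
      have h2 : ∀ w ∈ τ \ ρ, psgn w τ * g (ρ, τ.erase w) =
          -((-1) ^ ρ.card * psgn (u ρ) T * (psgn w T * e (ρ, T.erase w))) := by
        intro w hw
        have hwτ := (mem_sdiff.mp hw).1
        have hne : u ρ ≠ w := fun h' => huτ (h' ▸ hwτ)
        rw [hg_apply w hw fun h' => huτ (mem_of_mem_erase h'), ← erase_insert_of_ne hne]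
        have h3 := psgn_mul_psgn_erase huT (mem_insert_of_mem hwτ) hne
        rw [erase_insert huτ] at h3
        linear_combination ((-1) ^ ρ.card * e (ρ, T.erase w)) *
          (psgn (u ρ) T * psgn (u ρ) (T.erase w) * h3 -
            psgn w τ * psgn (u ρ) (T.erase w) * psgn_mul_self (u ρ) T -
            psgn (u ρ) T * psgn w T * psgn_mul_self (u ρ) (T.erase w))
      rw [Finset.sum_congr rfl h2, Finset.sum_neg_distrib, ← Finset.mul_sum]
      linear_combination (-(((-1) ^ ρ.card * (-1) ^ ρ.card) * psgn (u ρ) T)) * h1 +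
        e (ρ, τ) * psgn_mul_self (u ρ) T * ((-1) ^ ρ.card * (-1) ^ ρ.card) + e (ρ, τ) * hsq

lemma mem_Z2_dvL {K : SC} {p q : ℤ} {g : Pr → ℤ} (hg : g ∈ Ngr ℤ K p (q - 1)) :
    dvL ℤ K g ∈ Z2 ℤ K p q := by
  refine ⟨⟨dvL_mem_Ngr hg, dvL_dvL K g⟩, -dhL ℤ K g, neg_mem (dhL_mem_Ngr hg), ?_⟩
  rw [map_neg, dhL_dvL]

lemma eq_zero_of_mem_Ngr_simplex {σ : Finset ℕ} {n : ℕ} (hσ : σ.card = n + 1) {e : Pr → ℤ}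
    (he : e ∈ Ngr ℤ (simplex σ) n n) (h0 : e (σ, σ) = 0) : e = 0 := by
  ext ⟨ρ, τ⟩
  by_contra h
  obtain ⟨h1, h2, -, h4, h5⟩ := he _ h
  simp only at h1 h2 h4 h5
  obtain rfl : τ = σ := eq_of_subset_of_card_le (mem_powerset.mp h2) (by omega)
  obtain rfl : ρ = τ := eq_of_subset_of_card_le h1 (by omega)
  exact h h0

section Union

variable {K L : SC} {σ : Finset ℕ} {n : ℕ} {c₀ : Pr → ℤ}

lemma exists_lift (hσ : σ.card = n + 1) (hK : (simplex σ).IsSub K) (hc₀ : c₀ ∈ Z2 ℤ K n n)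
    (hc₀σ : c₀ (σ, σ) = 1) {p q : ℤ} {e : Pr → ℤ} (he : e ∈ Ngr ℤ (simplex σ) p q)
    (hv : dvL ℤ (simplex σ) e = 0) :
    ∃ a ∈ Z2 ℤ K p q, res (simplex σ) a = e ∧
      (a ∈ Submodule.map (dvL ℤ K) (Ngr ℤ K p (q - 1)) ∨
        (p = n ∧ q = n) ∧ ∃ m : ℤ, a = m • c₀) := by
  by_cases h : e (σ, σ) = 0
  · obtain ⟨g, hg, hge⟩ := exists_dvL_eq_of_simplex he hv h
    have hgK := Ngr_mono hK p (q - 1) hg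
    refine ⟨dvL ℤ K g, mem_Z2_dvL hgK, ?_, Or.inl ⟨g, hgK, rfl⟩⟩
    rw [res_dvL hK, res_eq_self hg, hge]
  · obtain ⟨-, -, -, h4, h5⟩ := he _ h
    simp only at h4 h5
    obtain rfl : p = n := by omega
    obtain rfl : q = n := by omega
    have ha := (Z2 ℤ K n n).smul_mem (e (σ, σ)) hc₀
    refine ⟨_, ha, ?_, Or.inr ⟨⟨rfl, rfl⟩, _, rfl⟩⟩
    rw [← sub_eq_zero]
    refine eq_zero_of_mem_Ngr_simplex hσ (sub_mem (res_mem_Ngr ha.1.1) he) ?_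
    rw [Pi.sub_apply, res_apply_of_mem (mem_powerset_self σ), Pi.smul_apply, hc₀σ]
    simp

variable (hσ : σ.card = n + 1) (hKL : K.faces ∩ L.faces = σ.powerset)
  (hc₀ : c₀ ∈ Z2 ℤ K n n) (hc₀σ : c₀ (σ, σ) = 1)

lemma simplex_isSub_left (hKL : K.faces ∩ L.faces = σ.powerset) : (simplex σ).IsSub K :=
  fun _ h => (mem_inter.mp (hKL.superset h)).1

lemma simplex_isSub_right (hKL : K.faces ∩ L.faces = σ.powerset) : (simplex σ).IsSub L :=
  fun _ h => (mem_inter.mp (hKL.superset h)).2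

lemma res_res {M K : SC} (hM : M.IsSub K) (c : Pr → ℤ) : res M (res K c) = res M c := by
  ext ⟨ρ, τ⟩
  by_cases h : τ ∈ M.faces
  · rw [res_apply_of_mem h, res_apply_of_mem h, res_apply_of_mem (hM h)]
  · rw [res_apply_of_notMem h, res_apply_of_notMem h]

lemma res_simplex_comm (hKL : K.faces ∩ L.faces = σ.powerset) (c : Pr → ℤ) :
    res (simplex σ) (res K c) = res (simplex σ) (res L c) := by
  rw [res_res (simplex_isSub_left hKL), res_res (simplex_isSub_right hKL)]

include hσ hKL hc₀ hc₀σ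

lemma exists_glue_lift {p q : ℤ} {a b : Pr → ℤ} (ha : a ∈ Ngr ℤ K p q) (hb : b ∈ Ngr ℤ L p q)
    (hab : dvL ℤ (simplex σ) (res (simplex σ) a) = dvL ℤ (simplex σ) (res (simplex σ) b)) :
    ∃ a' ∈ Z2 ℤ K p q, (a' ∈ Submodule.map (dvL ℤ K) (Ngr ℤ K p (q - 1)) ∨
        (p = n ∧ q = n) ∧ ∃ m : ℤ, a' = m • c₀) ∧
      ∃ c ∈ Ngr ℤ (K.union L) p q, res K c = a - a' ∧ res L c = b := by
  obtain ⟨a', ha', hres, hor⟩ := exists_lift hσ (simplex_isSub_left hKL) hc₀ hc₀σ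
    (sub_mem (res_mem_Ngr ha) (res_mem_Ngr hb)) (by rw [map_sub, hab, sub_self])
  refine ⟨a', ha', hor, exists_glue (S := simplex σ) hKL (sub_mem ha ha'.1.1) hb ?_⟩
  rw [map_sub, hres, sub_sub_cancel]

lemma mem_map_dvL_of_res {p q : ℤ} {c : Pr → ℤ}
    (hc : ∀ ρ τ, ¬(K.union L).IsPair ρ τ → c (ρ, τ) = 0)
    (hK : res K c ∈ Submodule.map (dvL ℤ K) (Ngr ℤ K p q))
    (hL : res L c ∈ Submodule.map (dvL ℤ L) (Ngr ℤ L p q)) :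
    c ∈ Submodule.map (dvL ℤ (K.union L)) (Ngr ℤ (K.union L) p q) := by
  obtain ⟨a, ha, hac⟩ := hK
  obtain ⟨b, hb, hbc⟩ := hL
  obtain ⟨a', ha', -, g, hg, hgK, hgL⟩ := exists_glue_lift hσ hKL hc₀ hc₀σ ha hb <| by
    rw [← res_dvL (simplex_isSub_left hKL), ← res_dvL (simplex_isSub_right hKL), hac, hbc,
      res_simplex_comm hKL]
  refine ⟨g, hg, (sub_eq_zero.mp (eq_zero_of_res (K := K) (L := L) ?_ ?_ ?_))⟩
  · intro ρ τ h
    rw [Pi.sub_apply, hc ρ τ h, dvL_apply_of_not h, sub_zero]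
  · rw [map_sub, res_dvL (IsSub_union_left K L), hgK, map_sub, LinearMap.mem_ker.mp ha'.1.2, hac]
    simp
  · rw [map_sub, res_dvL (IsSub_union_right K L), hgL, hbc, sub_self]

lemma mem_B2_of_res {p q : ℤ} {c : Pr → ℤ} (hc : c ∈ Ngr ℤ (K.union L) p q)
    (hK : res K c ∈ B2 ℤ K p q) (hL : res L c ∈ B2 ℤ L p q) : c ∈ B2 ℤ (K.union L) p q := by
  refine ⟨?_, hc⟩
  obtain ⟨x, hx, y, ⟨α, ⟨hα, hα0⟩, rfl⟩, hxy⟩ := Submodule.mem_sup.mp hK.1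
  obtain ⟨z, hz, w, ⟨β, ⟨hβ, hβ0⟩, rfl⟩, hzw⟩ := Submodule.mem_sup.mp hL.1
  have hα0 : dvL ℤ K α = 0 := hα0
  have hβ0 : dvL ℤ L β = 0 := hβ0
  obtain ⟨α', ha', -, γ, hγ, hγK, hγL⟩ := exists_glue_lift hσ hKL hc₀ hc₀σ hα hβ <| by
    rw [← res_dvL (simplex_isSub_left hKL), ← res_dvL (simplex_isSub_right hKL), hα0, hβ0,
      map_zero]
  have hγ0 : dvL ℤ (K.union L) γ = 0 := by
    refine eq_zero_of_res (K := K) (L := L) (fun ρ τ h => dvL_apply_of_not h _) ?_ ?_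
    · rw [res_dvL (IsSub_union_left K L), hγK, map_sub, hα0, LinearMap.mem_ker.mp ha'.1.2,
        sub_zero]
    · rw [res_dvL (IsSub_union_right K L), hγL, hβ0]
  have hmain : c - dhL ℤ (K.union L) γ ∈
      Submodule.map (dvL ℤ (K.union L)) (Ngr ℤ (K.union L) p (q - 1)) := by
    refine mem_map_dvL_of_res hσ hKL hc₀ hc₀σ (fun ρ τ h => ?_) ?_ ?_
    · rw [Pi.sub_apply, dhL_apply_of_not h, apply_eq_zero_of_mem_Ngr hc fun h' => h h'.1, sub_zero]
    · rw [map_sub, res_dhL (IsSub_union_left K L), hγK, ← hxy, map_sub]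
      have h3 : dhL ℤ K α' ∈ Submodule.map (dvL ℤ K) (Ngr ℤ K (p + 1 - 1) (q - 1)) := ha'.2
      rw [add_sub_cancel_right] at h3
      convert add_mem hx h3 using 1
      abel
    · rw [map_sub, res_dhL (IsSub_union_right K L), hγL, ← hzw, add_sub_cancel_right]
      exact hz
  exact Submodule.mem_sup.mpr ⟨_, hmain, _, ⟨γ, ⟨hγ, hγ0⟩, rfl⟩, sub_add_cancel _ _⟩

lemma exists_mem_Z2_union {p q : ℤ} {a b : Pr → ℤ} (ha : a ∈ Z2 ℤ K p q) (hb : b ∈ Z2 ℤ L p q) :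
    ∃ a' ∈ Z2 ℤ K p q, (a' ∈ Submodule.map (dvL ℤ K) (Ngr ℤ K p (q - 1)) ∨
        (p = n ∧ q = n) ∧ ∃ m : ℤ, a' = m • c₀) ∧
      ∃ c ∈ Z2 ℤ (K.union L) p q, res K c = a - a' ∧ res L c = b := by
  obtain ⟨a', ha', hor, c, hc, hcK, hcL⟩ := exists_glue_lift hσ hKL hc₀ hc₀σ ha.1.1 hb.1.1 <| by
    rw [← res_dvL (simplex_isSub_left hKL), ← res_dvL (simplex_isSub_right hKL),
      LinearMap.mem_ker.mp ha.1.2, LinearMap.mem_ker.mp hb.1.2, map_zero]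
  have hsub := sub_mem ha ha'
  refine ⟨a', ha', hor, c, ⟨⟨hc, ?_⟩, ?_⟩, hcK, hcL⟩
  · refine eq_zero_of_res (K := K) (L := L) (fun ρ τ h => dvL_apply_of_not h _) ?_ ?_
    · rw [res_dvL (IsSub_union_left K L), hcK, LinearMap.mem_ker.mp hsub.1.2]
    · rw [res_dvL (IsSub_union_right K L), hcL, LinearMap.mem_ker.mp hb.1.2]
  · refine mem_map_dvL_of_res hσ hKL hc₀ hc₀σ (fun ρ τ h => dhL_apply_of_not h _) ?_ ?_
    · rw [res_dhL (IsSub_union_left K L), hcK]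
      exact hsub.2
    · rw [res_dhL (IsSub_union_right K L), hcL]
      exact hb.2

end Union

lemma cAdj_symm {K : SC} {s t : Finset ℕ} (h : cAdj K s t) : cAdj K t s :=
  ⟨h.2.1, h.1, h.2.2.1.symm, by rw [inter_comm, h.2.2.2, h.2.2.1]⟩

lemma reflTransGen_cAdj_symm {K : SC} {s t : Finset ℕ}
    (h : Relation.ReflTransGen (cAdj K) s t) : Relation.ReflTransGen (cAdj K) t s := by
  induction h with
  | refl => exact .refl
  | tail _ h ih => exact .head (cAdj_symm h) ih

lemma cAdj_mono {M K : SC} (hM : M.IsSub K) {s t : Finset ℕ} (h : cAdj M s t) : cAdj K s t :=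
  ⟨hM h.1, hM h.2.1, h.2.2⟩

lemma reflTransGen_cAdj_of_subset {K : SC} {μ : Finset ℕ} (hμ : μ ∈ K.faces) {t : Finset ℕ}
    (ht : t ⊆ μ) {s : Finset ℕ} (hs : s ⊆ μ) (hst : s.card = t.card) :
    Relation.ReflTransGen (cAdj K) s t := by
  induction hk : (s \ t).card generalizing s with
  | zero =>
    obtain rfl : s = t :=
      eq_of_subset_of_card_le (sdiff_eq_empty_iff_subset.mp (card_eq_zero.mp hk)) hst.ge
    exact .refl
  | succ k ih =>
    obtain ⟨x, hx⟩ : (s \ t).Nonempty := card_pos.mp (by omega)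
    obtain ⟨y, hy⟩ : (t \ s).Nonempty :=
      card_pos.mp (by have := card_sdiff_comm hst; omega)
    have hxs := mem_sdiff.mp hx
    have hyt := mem_sdiff.mp hy
    have hcard : (insert y (s.erase x)).card = s.card := by
      rw [card_insert_of_notMem fun h => hyt.2 (mem_of_mem_erase h), card_erase_add_one hxs.1]
    have hsub : insert y (s.erase x) ⊆ μ :=
      insert_subset (ht hyt.1) ((erase_subset _ _).trans hs)
    have hinter : s ∩ insert y (s.erase x) = s.erase x := by
      rw [inter_insert_of_notMem hyt.2, inter_eq_right.mpr (erase_subset _ _)]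
    have hsdiff : insert y (s.erase x) \ t = (s \ t).erase x := by
      rw [insert_sdiff_of_mem _ hyt.1, erase_sdiff_comm]
    refine .head ⟨K.down_closed hμ hs, K.down_closed hμ hsub, hcard.symm, ?_⟩
      (ih hsub (hcard.trans hst) ?_)
    · rw [hinter, card_erase_add_one hxs.1]
    · rw [hsdiff, card_erase_of_mem hx, hk, Nat.add_sub_cancel]

lemma CompConn.union_simplex {M : SC} (hM : CompConn M) {μ : Finset ℕ}
    (h : ∀ s ⊆ μ,
      (∃ t ∈ M.faces, t.card = s.card ∧
        Relation.ReflTransGen (cAdj (M.union (simplex μ))) s t) ∨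
      ∀ t ∈ (M.union (simplex μ)).faces, t.card = s.card → t = s) :
    CompConn (M.union (simplex μ)) := by
  have h' : ∀ s ∈ (M.union (simplex μ)).faces,
      (∃ t ∈ M.faces, t.card = s.card ∧
        Relation.ReflTransGen (cAdj (M.union (simplex μ))) s t) ∨
      ∀ t ∈ (M.union (simplex μ)).faces, t.card = s.card → t = s := by
    intro s hs
    rcases mem_union.mp hs with hs | hs
    · exact Or.inl ⟨s, hs, rfl, .refl⟩
    · exact h s (mem_powerset.mp hs)
  intro s hs t ht hst
  rcases h' s hs with ⟨s', hs', hss', hgen⟩ | hu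
  swap
  · rw [hu t ht hst.symm]
  rcases h' t ht with ⟨t', ht', htt', hgen'⟩ | hu
  swap
  · rw [hu s hs hst]
  exact (hgen.trans (Relation.ReflTransGen.mono (fun _ _ =>
    cAdj_mono (IsSub_union_left _ _)) _ _ (hM s' hs' t' ht' (by omega)))).trans (reflTransGen_cAdj_symm hgen')

lemma mem_union_simplex_self (M : SC) (μ : Finset ℕ) : μ ∈ (M.union (simplex μ)).faces :=
  mem_union_right _ (mem_powerset_self μ)

section Component

variable {K M : SC} {n : ℕ}

lemma IsCCComp.mem_of_compConn (hM : IsCCComp K M) {μ : Finset ℕ} (hμ : μ ∈ K.faces)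
    (h : CompConn (M.union (simplex μ))) : μ ∈ M.faces := by
  rw [← hM.2.2 (M.union (simplex μ)) (union_subset hM.1 fun s hs => K.down_closed hμ (mem_powerset.mp hs)) h
    (IsSub_union_left _ _)]
  exact mem_union_simplex_self M μ

lemma card_le_of_dim (hdim : M.dim = n) {s : Finset ℕ} (hs : s ∈ M.faces) : s.card ≤ n + 1 := by
  have h1 : s.card ≤ M.faces.sup Finset.card := le_sup hs
  have h2 : ((M.faces.sup Finset.card : ℕ) : ℤ) - 1 = n := hdim
  omega

lemma IsCCComp.eq_of_subset (hM : IsCCComp K M) (hdim : M.dim = n) {ρ τ : Finset ℕ}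
    (hρ : ρ ∈ M.faces) (hcard : ρ.card = n + 1) (hτ : τ ∈ K.faces) (hρτ : ρ ⊆ τ) : τ = ρ := by
  by_contra hne
  obtain ⟨x, hx⟩ := sdiff_nonempty.mpr fun h => hne (h.antisymm hρτ)
  rw [mem_sdiff] at hx
  have hμcard := card_insert_of_notMem hx.2
  have hμ : insert x ρ ∈ M.faces := by
    refine hM.mem_of_compConn (K.down_closed hτ (insert_subset hx.1 hρτ))
      (hM.2.1.union_simplex fun s hs => ?_)
    by_cases hsc : s.card ≤ ρ.card
    · obtain ⟨t, ht, htc⟩ := exists_subset_card_eq hsc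
      exact Or.inl ⟨t, M.down_closed hρ ht, htc, reflTransGen_cAdj_of_subset
        (mem_union_simplex_self M _) (ht.trans (subset_insert _ _)) hs htc.symm⟩
    · obtain rfl : s = insert x ρ := eq_of_subset_of_card_le hs (by omega)
      refine Or.inr fun t ht htc => ?_
      rcases mem_union.mp ht with ht | ht
      · have := card_le_of_dim hdim ht
        omega
      · exact eq_of_subset_of_card_le (mem_powerset.mp ht) htc.ge
  have := card_le_of_dim hdim hμ
  omega

lemma IsCCComp.mem_of_adj (hM : IsCCComp K M) {ρ τ τ' : Finset ℕ} (hτ' : τ' ∈ M.faces)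
    (hcard' : τ'.card = n + 1) (hτ : τ ∈ K.faces) (hcard : τ.card = n + 1) (hρ : ρ.card = n)
    (hρτ : ρ ⊆ τ) (hρτ' : ρ ⊆ τ') : τ ∈ M.faces := by
  by_cases hne : τ = τ'
  · exact hne ▸ hτ'
  refine hM.mem_of_compConn hτ (hM.2.1.union_simplex fun s hs => Or.inl ?_)
  by_cases hsc : s.card ≤ ρ.card
  · obtain ⟨t, ht, htc⟩ := exists_subset_card_eq hsc
    exact ⟨t, M.down_closed hτ' (ht.trans hρτ'), htc, reflTransGen_cAdj_of_subset
      (mem_union_simplex_self M _) (ht.trans hρτ) hs htc.symm⟩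
  · obtain rfl : s = τ := eq_of_subset_of_card_le hs (by omega)
    refine ⟨τ', hτ', by omega, .single ⟨mem_union_simplex_self M _, mem_union_left _ hτ',
      by omega, ?_⟩⟩
    have h1 := card_le_card (subset_inter hρτ hρτ')
    have h2 : (s ∩ τ').card ≠ n + 1 := fun h => hne <|
      (eq_of_subset_of_card_le inter_subset_left (by omega)).symm.trans
        (eq_of_subset_of_card_le inter_subset_right (by omega))
    have h3 := card_le_card (inter_subset_left (s₁ := s) (s₂ := τ'))
    omega

/-- The indicator cochain of the top-dimensional simplices of `M`. -/
def topCochain (M : SC) (n : ℕ) : Pr → ℤ := fun x =>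
  if x.1 = x.2 ∧ x.2 ∈ M.faces ∧ x.2.card = n + 1 then 1 else 0

open Classical in
lemma IsCCComp.topCochain_mem_Z2 (hM : IsCCComp K M) (hdim : M.dim = n) :
    topCochain M n ∈ Z2 ℤ K n n := by
  refine ⟨⟨mem_Ngr_of fun ρ τ h0 => ?_, ?_⟩, ?_⟩
  · obtain ⟨h1, h2, h3⟩ : ρ = τ ∧ τ ∈ M.faces ∧ τ.card = n + 1 := by
      by_contra h
      exact h0 (if_neg h)
    subst h1
    exact ⟨⟨hM.1 h2, Subset.rfl, fun h => by simp [h] at h3⟩, by omega, by omega⟩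
  · ext ⟨ρ, τ⟩
    by_cases h : K.IsPair ρ τ
    swap
    · exact dvL_apply_of_not h _
    rw [dvL_apply h, Finset.sum_eq_zero, mul_zero, Pi.zero_apply]
    intro w hw
    have : topCochain M n (ρ, τ.erase w) = 0 := by
      refine if_neg ?_
      rintro ⟨-, h2, h3⟩
      dsimp only at h2 h3
      have := hM.eq_of_subset hdim h2 h3 h.1 (erase_subset _ _)
      exact notMem_erase w τ (this ▸ (mem_sdiff.mp hw).1)
    rw [this, mul_zero]
  · set e : Pr → ℤ := fun x =>
      if x.1 = x.2 ∧ x.2 ≠ ∅ ∧ x.2.card = n ∧ ∃ τ ∈ M.faces, τ.card = n + 1 ∧ x.2 ⊆ τ then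
        (-1) ^ n else 0
    refine ⟨e, mem_Ngr_of fun ρ τ h0 => ?_, ?_⟩
    · obtain ⟨h1, h2, h3, τ', hτ', -, hsub⟩ :
          ρ = τ ∧ τ ≠ ∅ ∧ τ.card = n ∧ ∃ τ' ∈ M.faces, τ'.card = n + 1 ∧ τ ⊆ τ' := by
        by_contra h
        exact h0 (if_neg h)
      subst h1
      exact ⟨⟨hM.1 (M.down_closed hτ' hsub), Subset.rfl, h2⟩, by omega, by omega⟩
    · ext ⟨ρ, τ⟩
      by_cases h : K.IsPair ρ τ
      swap
      · rw [dvL_apply_of_not h, dhL_apply_of_not h]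
      rw [dvL_apply h, dhL_apply h, Finset.mul_sum]
      refine Finset.sum_congr rfl fun w hw => ?_
      rw [mem_sdiff] at hw
      have hiff : insert w ρ = τ ↔ ρ = τ.erase w :=
        ⟨fun h' => by rw [← h', erase_insert hw.2], fun h' => by rw [h', insert_erase hw.1]⟩
      by_cases hins : insert w ρ = τ ∧ τ ∈ M.faces ∧ τ.card = n + 1
      · have h1 : topCochain M n (insert w ρ, τ) = 1 := if_pos hins
        have h2 := hiff.mp hins.1
        have h3 := card_insert_of_notMem hw.2
        rw [hins.1, hins.2.2] at h3
        have h4 : e (ρ, τ.erase w) = (-1) ^ n :=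
          if_pos ⟨h2, h2 ▸ h.2.2, by simpa [← h2] using h3.symm, τ, hins.2.1, hins.2.2, erase_subset _ _⟩
        rw [h1, h4, hins.1, show ρ.card = n by omega]
        have hsq : ((-1 : ℤ) ^ n) * (-1) ^ n = 1 := by
          rw [← mul_pow]
          simp
        linear_combination psgn w τ * hsq
      · have h1 : topCochain M n (insert w ρ, τ) = 0 := if_neg hins
        have h2 : e (ρ, τ.erase w) = 0 := by
          refine if_neg ?_
          rintro ⟨h3, -, h4, τ', hτ', hcard', hsub⟩
          have hcard := card_erase_add_one hw.1
          dsimp only at h4 hsub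
          exact hins ⟨hiff.mpr h3, hM.mem_of_adj hτ' hcard' h.1 (by omega) h4 (erase_subset _ _) hsub, by omega⟩
        rw [h1, h2, mul_zero, mul_zero, mul_zero]

lemma topCochain_self {σ : Finset ℕ} (hσ : σ ∈ M.faces) (hcard : σ.card = n + 1) :
    topCochain M n (σ, σ) = 1 :=
  if_pos ⟨rfl, hσ, hcard⟩

end Component

section Main

variable {K L : SC} {σ : Finset ℕ} {n : ℕ} {c₀ : Pr → ℤ}

lemma B2_diag (K : SC) (n : ℤ) : B2 ℤ K n n = ⊥ := by
  have h : ∀ p q : ℤ, q < p → Ngr ℤ K p q = ⊥ := fun p q hpq => by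
    refine (Submodule.eq_bot_iff _).mpr fun c hc => ?_
    ext ⟨ρ, τ⟩
    refine apply_eq_zero_of_mem_Ngr hc fun ⟨h, h1, h2⟩ => ?_
    have := card_le_card h.2.1
    omega
  rw [B2, h n (n - 1) (by omega), h (n + 1) n (by omega)]
  simp

/-- Restriction of cohomeology classes of a union to both pieces. -/
def resProd (K L : SC) (p q : ℤ) : HH ℤ (K.union L) p q →ₗ[ℤ] HH ℤ K p q × HH ℤ L p q :=
  (resHH (IsSub_union_left K L) p q).prod (resHH (IsSub_union_right K L) p q)

lemma mk_eq_zero_iff {p q : ℤ} {c : Pr → ℤ} (hc : c ∈ Z2 ℤ K p q) :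
    (Submodule.Quotient.mk ⟨c, hc⟩ : HH ℤ K p q) = 0 ↔ c ∈ B2 ℤ K p q :=
  Submodule.Quotient.mk_eq_zero _

variable (hσ : σ.card = n + 1) (hKL : K.faces ∩ L.faces = σ.powerset)
  (hc₀ : c₀ ∈ Z2 ℤ K n n) (hc₀σ : c₀ (σ, σ) = 1)

include hσ hKL hc₀ hc₀σ

lemma resProd_injective (p q : ℤ) : Function.Injective (resProd K L p q) := by
  refine (injective_iff_map_eq_zero _).mpr fun x hx => ?_
  obtain ⟨⟨c, hc⟩, rfl⟩ := Submodule.Quotient.mk_surjective _ x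
  have h1 := (mk_eq_zero_iff (res_mem_Z2 (IsSub_union_left K L) hc)).mp (congrArg Prod.fst hx)
  have h2 := (mk_eq_zero_iff (res_mem_Z2 (IsSub_union_right K L) hc)).mp (congrArg Prod.snd hx)
  exact (mk_eq_zero_iff hc).mpr (mem_B2_of_res hσ hKL hc₀ hc₀σ hc.1.1 h1 h2)

lemma exists_resProd_eq {p q : ℤ} (y : HH ℤ K p q × HH ℤ L p q) :
    ∃ x, ∃ a, ∃ ha : a ∈ Z2 ℤ K p q,
      (a ∈ Submodule.map (dvL ℤ K) (Ngr ℤ K p (q - 1)) ∨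
        (p = n ∧ q = n) ∧ ∃ m : ℤ, a = m • c₀) ∧
      resProd K L p q x = y - (Submodule.Quotient.mk ⟨a, ha⟩, 0) := by
  obtain ⟨y₁, y₂⟩ := y
  obtain ⟨⟨a, ha⟩, rfl⟩ := Submodule.Quotient.mk_surjective _ y₁
  obtain ⟨⟨b, hb⟩, rfl⟩ := Submodule.Quotient.mk_surjective _ y₂
  obtain ⟨a', ha', hor, c, hc, hcK, hcL⟩ := exists_mem_Z2_union hσ hKL hc₀ hc₀σ ha hb
  refine ⟨Submodule.Quotient.mk ⟨c, hc⟩, a', ha', hor, Prod.ext ?_ ?_⟩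
  · exact congrArg Submodule.Quotient.mk (Subtype.ext hcK)
  · rw [Prod.snd_sub, sub_zero]
    exact congrArg Submodule.Quotient.mk (Subtype.ext hcL)

lemma resProd_surjective {p q : ℤ} (hpq : ¬(p = n ∧ q = n)) :
    Function.Surjective (resProd K L p q) := by
  intro y
  obtain ⟨x, a, ha, hor, hx⟩ := exists_resProd_eq hσ hKL hc₀ hc₀σ y
  have h := hor.resolve_right fun h => hpq h.1
  refine ⟨x, ?_⟩
  rw [hx, (mk_eq_zero_iff ha).mpr ⟨Submodule.mem_sup_left h, ha.1.1⟩, Prod.mk_zero_zero, sub_zero]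

theorem HH_union_of_cochain :
    (∃ Z : Submodule ℤ (HH ℤ K (n : ℤ) (n : ℤ) × HH ℤ L (n : ℤ) (n : ℤ)),
      Nonempty (Z ≃+ ℤ) ∧
      Nonempty (((HH ℤ K (n : ℤ) (n : ℤ) × HH ℤ L (n : ℤ) (n : ℤ)) ⧸ Z) ≃+
        HH ℤ (K.union L) (n : ℤ) (n : ℤ))) ∧
    ∀ p q : ℤ, ¬(p = n ∧ q = n) →
      Nonempty (HH ℤ (K.union L) p q ≃+ HH ℤ K p q × HH ℤ L p q) := by
  refine ⟨?_, fun p q hpq => ⟨(LinearEquiv.ofBijective (resProd K L p q)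
    ⟨resProd_injective hσ hKL hc₀ hc₀σ p q,
      resProd_surjective hσ hKL hc₀ hc₀σ hpq⟩).toAddEquiv⟩⟩
  let f : ℤ →ₗ[ℤ] HH ℤ K (n : ℤ) (n : ℤ) × HH ℤ L (n : ℤ) (n : ℤ) :=
    LinearMap.toSpanSingleton ℤ _ (Submodule.Quotient.mk ⟨c₀, hc₀⟩, 0)
  have hf : ∀ m : ℤ, f m =
      (Submodule.Quotient.mk ⟨m • c₀, (Z2 ℤ K n n).smul_mem m hc₀⟩, 0) := fun m =>
    Prod.ext rfl (smul_zero m)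
  have hfinj : Function.Injective f := by
    refine (injective_iff_map_eq_zero _).mpr fun m hm => ?_
    rw [hf] at hm
    have h := (mk_eq_zero_iff _).mp (congrArg Prod.fst hm)
    rw [B2_diag, Submodule.mem_bot] at h
    simpa [hc₀σ] using congrFun h (σ, σ)
  refine ⟨LinearMap.range f, ⟨(LinearEquiv.ofInjective f hfinj).symm.toAddEquiv⟩, ?_⟩
  refine ⟨(LinearEquiv.ofBijective ((LinearMap.range f).mkQ ∘ₗ resProd K L n n)
    ⟨?_, ?_⟩).symm.toAddEquiv⟩
  · refine (injective_iff_map_eq_zero _).mpr fun x hx => ?_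
    obtain ⟨m, hm⟩ := (Submodule.Quotient.mk_eq_zero _).mp hx
    rw [hf] at hm
    obtain ⟨⟨c, hc⟩, rfl⟩ := Submodule.Quotient.mk_surjective _ x
    have hK := (Submodule.Quotient.eq _).mp (congrArg Prod.fst hm)
    have hL := (mk_eq_zero_iff (res_mem_Z2 (IsSub_union_right K L) hc)).mp
      (congrArg Prod.snd hm).symm
    have hK' : m • c₀ - res K c ∈ B2 ℤ K n n := hK
    rw [B2_diag, Submodule.mem_bot] at hL hK'
    have hσKL : σ ∈ K.faces ∩ L.faces := hKL.superset (mem_powerset_self σ)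
    have h1 := congrFun hL (σ, σ)
    have h2 := congrFun hK' (σ, σ)
    rw [res_apply_of_mem (mem_inter.mp hσKL).2, Pi.zero_apply] at h1
    rw [Pi.sub_apply, res_apply_of_mem (mem_inter.mp hσKL).1, h1, Pi.smul_apply, hc₀σ] at h2
    obtain rfl : m = 0 := by simpa using h2
    refine resProd_injective hσ hKL hc₀ hc₀σ n n ?_
    rw [map_zero, ← hm, ← hf, map_zero]
  · intro y
    obtain ⟨y, rfl⟩ := Submodule.Quotient.mk_surjective _ y
    obtain ⟨x, a, ha, hor, hx⟩ := exists_resProd_eq hσ hKL hc₀ hc₀σ y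
    refine ⟨x, (Submodule.Quotient.eq _).mpr ?_⟩
    rw [hx, sub_sub_cancel_left]
    refine neg_mem ?_
    rcases hor with h | ⟨-, m, rfl⟩
    · rw [(mk_eq_zero_iff ha).mpr ⟨Submodule.mem_sup_left h, ha.1.1⟩, Prod.mk_zero_zero]
      exact zero_mem _
    · exact ⟨m, hf m⟩

end Main

lemma union_comm (K L : SC) : K.union L = L.union K := by
  simp only [union, Finset.union_comm]

end SC

/-- If `K ∩ L = 2^σ` with `dim σ = n` and `K` (or `L`) has an
`n`-dimensional completely connected component containing `σ`, then
`𝓗^{n,n}(K ∪ L) ≅ (𝓗^{n,n}(K) ⊕ 𝓗^{n,n}(L))/ℤ` and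
`𝓗^{p,q}(K ∪ L) ≅ 𝓗^{p,q}(K) ⊕ 𝓗^{p,q}(L)` for all other `(p,q)`. -/
theorem HH_union_along_simplex (K L : SC) (σ : Finset ℕ) (n : ℕ)
    (hσ : σ.card = n + 1) (hKL : K.faces ∩ L.faces = σ.powerset)
    (hcc : (∃ K₁ : SC, SC.IsCCComp K K₁ ∧ K₁.dim = (n : ℤ) ∧ σ ∈ K₁.faces) ∨
           (∃ L₁ : SC, SC.IsCCComp L L₁ ∧ L₁.dim = (n : ℤ) ∧ σ ∈ L₁.faces)) :
    (∃ Z : Submodule ℤ (SC.HH ℤ K (n : ℤ) (n : ℤ) × SC.HH ℤ L (n : ℤ) (n : ℤ)),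
      Nonempty (Z ≃+ ℤ) ∧
      Nonempty (((SC.HH ℤ K (n : ℤ) (n : ℤ) × SC.HH ℤ L (n : ℤ) (n : ℤ)) ⧸ Z) ≃+
        SC.HH ℤ (K.union L) (n : ℤ) (n : ℤ))) ∧
    ∀ p q : ℤ, ¬(p = n ∧ q = n) →
      Nonempty (SC.HH ℤ (K.union L) p q ≃+ SC.HH ℤ K p q × SC.HH ℤ L p q) := by
  rcases hcc with ⟨M, hM, hdim, hσM⟩ | ⟨M, hM, hdim, hσM⟩
  · exact SC.HH_union_of_cochain hσ hKL (hM.topCochain_mem_Z2 hdim) (SC.topCochain_self hσM hσ)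
  · rw [inter_comm] at hKL
    obtain ⟨⟨Z, ⟨e₁⟩, ⟨e₂⟩⟩, h⟩ := SC.HH_union_of_cochain hσ hKL (hM.topCochain_mem_Z2 hdim)
      (SC.topCochain_self hσM hσ)
    rw [SC.union_comm]
    let s := LinearEquiv.prodComm ℤ (SC.HH ℤ L n n) (SC.HH ℤ K n n)
    refine ⟨⟨Z.map s.toLinearMap, ⟨(s.submoduleMap Z).symm.toAddEquiv.trans e₁⟩,
      ⟨(Submodule.Quotient.equiv Z _ s rfl).symm.toAddEquiv.trans e₂⟩⟩, fun p q hpq => ?_⟩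
    obtain ⟨e⟩ := h p q hpq
    exact ⟨e.trans AddEquiv.prodComm⟩
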